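/- arXiv:1604.00146 — 2 statements merged into one kernel-verified Lean document; each statement's English description precedes it below -/
import Mathlib

section
/- Let (E, ⋆, ρ, (·,·)₋, D) be a pre-symplectic algebroid datum over a commutative ℝ-algebra R. Then the commutator bracket [e₁,e₂] := e₁⋆e₂ − e₂⋆e₁ satisfies the Jacobi identity [e₁,[e₂,e₃]] + [e₂,[e₃,e₁]] + [e₃,[e₁,e₂]] = 0 and the Leibniz rule [e₁, f·e₂] = f·[e₁,e₂] + ρ(e₁)(f)·e₂, and the form ω := (·,·)₋ is closed: ρ(e₁)(ω(e₂,e₃)) − ρ(e₂)(ω(e₁,e₃)) + ρ(e₃)(ω(e₁,e₂)) − ω([e₁,e₂],e₃) + ω([e₁,e₃],e₂) − ω([e₂,e₃],e₁) = 0 for all e₁,e₂,e₃ ∈ E. In other words, (E, [·,·], ρ, ω) is a symplectic Lie algebroid datum. -/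
/-- A pre-symplectic algebroid datum over a commutative ℝ-algebra `R`
(modeling smooth functions on a manifold): an `R`-module `E` with an
ℝ-bilinear multiplication `⋆`, an anchor `ρ : E → Der_ℝ(R)`, a nondegenerate
R-bilinear skew-symmetric form `(·,·)₋`, and an ℝ-linear map `D : R → E` with
`(Df, e)₋ = ρ(e)(f)`, satisfying axioms (i) and (ii). -/
structure PreSympAlgebroid (R E : Type*) [CommRing R] [Algebra ℝ R]
    [AddCommGroup E] [Module R E] [Module ℝ E] [IsScalarTower ℝ R E] where
  star : E →ₗ[ℝ] E →ₗ[ℝ] E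
  rho : E →ₗ[R] Derivation ℝ R R
  form : E →ₗ[R] E →ₗ[R] R
  form_skew : ∀ e₁ e₂ : E, form e₁ e₂ = - form e₂ e₁
  form_nondeg : ∀ x : E, (∀ e : E, form x e = 0) → x = 0
  D : R →ₗ[ℝ] E
  form_D : ∀ (f : R) (e : E), form (D f) e = rho e f
  /-- Axiom (i): the symmetrized associator is (1/6)·D(T(e₁,e₂,e₃)). -/
  axiom_i : ∀ e₁ e₂ e₃ : E,
    star e₁ (star e₂ e₃) - star (star e₁ e₂) e₃
      - star e₂ (star e₁ e₃) + star (star e₂ e₁) e₃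
    = (6 : ℝ)⁻¹ • D (form (star e₁ e₂) e₃ + form e₁ (star e₂ e₃)
        - form (star e₂ e₁) e₃ - form e₂ (star e₁ e₃))
  /-- Axiom (ii). -/
  axiom_ii : ∀ e₁ e₂ e₃ : E,
    rho e₁ (form e₂ e₃)
      = form (star e₁ e₂ - (2 : ℝ)⁻¹ • D (form e₁ e₂)) e₃
        + form e₂ (star e₁ e₃ - star e₃ e₁)

namespace PreSympAlgebroid

variable {R E : Type*} [CommRing R] [Algebra ℝ R] [AddCommGroup E] [Module R E] [Module ℝ E]
  [IsScalarTower ℝ R E] (P : PreSympAlgebroid R E)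

theorem form_right_injective {x y : E} (h : ∀ e : E, P.form e x = P.form e y) : x = y := by
  refine sub_eq_zero.mp (P.form_nondeg _ fun e => ?_)
  rw [P.form_skew, map_sub, h e, sub_self, neg_zero]

theorem rho_form (e₁ e₂ e₃ : E) :
    P.rho e₁ (P.form e₂ e₃) = P.form (P.star e₁ e₂) e₃
      - (2 : ℝ)⁻¹ • P.rho e₃ (P.form e₁ e₂) + P.form e₂ (P.star e₁ e₃ - P.star e₃ e₁) := by
  rw [P.axiom_ii, map_sub, LinearMap.sub_apply, ← algebraMap_smul R (2 : ℝ)⁻¹ (P.D _), map_smul,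
    LinearMap.smul_apply, P.form_D, algebraMap_smul]

theorem jacobi (e₁ e₂ e₃ : E) :
    ((P.star e₁ (P.star e₂ e₃ - P.star e₃ e₂))
        - (P.star (P.star e₂ e₃ - P.star e₃ e₂) e₁))
      + ((P.star e₂ (P.star e₃ e₁ - P.star e₁ e₃))
        - (P.star (P.star e₃ e₁ - P.star e₁ e₃) e₂))
      + ((P.star e₃ (P.star e₁ e₂ - P.star e₂ e₁))
        - (P.star (P.star e₁ e₂ - P.star e₂ e₁) e₃)) = 0 := by
  have h := congrArg₂ (· + ·) (congrArg₂ (· + ·) (P.axiom_i e₁ e₂ e₃) (P.axiom_i e₂ e₃ e₁))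
    (P.axiom_i e₃ e₁ e₂)
  simp only [← smul_add, ← map_add] at h
  rw [P.form_skew e₁ (P.star e₂ e₃), P.form_skew e₂ (P.star e₁ e₃),
    P.form_skew e₂ (P.star e₃ e₁), P.form_skew e₃ (P.star e₂ e₁),
    P.form_skew e₃ (P.star e₁ e₂), P.form_skew e₁ (P.star e₃ e₂)] at h
  ring_nf at h
  rw [map_zero, smul_zero] at h
  simp only [map_sub, LinearMap.sub_apply]
  rw [← h]
  abel

theorem leibniz (e₁ e₂ : E) (f : R) :
    P.star e₁ (f • e₂) - P.star (f • e₂) e₁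
      = f • (P.star e₁ e₂ - P.star e₂ e₁) + P.rho e₁ f • e₂ := by
  refine P.form_right_injective fun e => ?_
  have h₁ := P.axiom_ii e₁ e (f • e₂)
  have h₂ := P.axiom_ii e₁ e e₂
  simp only [map_smul, smul_eq_mul, Derivation.leibniz] at h₁
  simp only [map_add, map_smul, smul_eq_mul]
  linear_combination f * h₂ - h₁

theorem form_closed (e₁ e₂ e₃ : E) :
    P.rho e₁ (P.form e₂ e₃) - P.rho e₂ (P.form e₁ e₃) + P.rho e₃ (P.form e₁ e₂)
      - P.form (P.star e₁ e₂ - P.star e₂ e₁) e₃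
      + P.form (P.star e₁ e₃ - P.star e₃ e₁) e₂
      - P.form (P.star e₂ e₃ - P.star e₃ e₂) e₁ = 0 := by
  have h₁ := P.rho_form e₁ e₂ e₃
  have h₂ := P.rho_form e₂ e₁ e₃
  rw [P.form_skew e₂ (_ - _)] at h₁
  rw [P.form_skew e₁ (_ - _), P.form_skew e₂ e₁, map_neg, smul_neg] at h₂
  have half : (2 : ℝ)⁻¹ • P.rho e₃ (P.form e₁ e₂) + (2 : ℝ)⁻¹ • P.rho e₃ (P.form e₁ e₂)
      = P.rho e₃ (P.form e₁ e₂) := by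
    rw [← add_smul, ← two_mul, mul_inv_cancel₀ two_ne_zero, one_smul]
  rw [map_sub, LinearMap.sub_apply]
  linear_combination h₁ - h₂ - half

end PreSympAlgebroid

/-- In a pre-symplectic algebroid datum, the commutator bracket
[e₁,e₂] := e₁⋆e₂ − e₂⋆e₁ satisfies the Jacobi identity and the Leibniz rule,
and the form ω := (·,·)₋ is closed; i.e. (E, [·,·], ρ, ω) is a symplectic Lie
algebroid datum. -/
theorem presymp_gives_symplectic_lie_algebroid
    (R E : Type*) [CommRing R] [Algebra ℝ R]
    [AddCommGroup E] [Module R E] [Module ℝ E] [IsScalarTower ℝ R E]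
    (P : PreSympAlgebroid R E) :
    (∀ e₁ e₂ e₃ : E,
      ((P.star e₁ (P.star e₂ e₃ - P.star e₃ e₂))
        - (P.star (P.star e₂ e₃ - P.star e₃ e₂) e₁))
      + ((P.star e₂ (P.star e₃ e₁ - P.star e₁ e₃))
        - (P.star (P.star e₃ e₁ - P.star e₁ e₃) e₂))
      + ((P.star e₃ (P.star e₁ e₂ - P.star e₂ e₁))
        - (P.star (P.star e₁ e₂ - P.star e₂ e₁) e₃)) = 0) ∧
    (∀ (e₁ e₂ : E) (f : R),
      P.star e₁ (f • e₂) - P.star (f • e₂) e₁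
        = f • (P.star e₁ e₂ - P.star e₂ e₁) + P.rho e₁ f • e₂) ∧
    (∀ e₁ e₂ e₃ : E,
      P.rho e₁ (P.form e₂ e₃) - P.rho e₂ (P.form e₁ e₃) + P.rho e₃ (P.form e₁ e₂)
        - P.form (P.star e₁ e₂ - P.star e₂ e₁) e₃
        + P.form (P.star e₁ e₃ - P.star e₃ e₁) e₂
        - P.form (P.star e₂ e₃ - P.star e₃ e₂) e₁ = 0) :=
  ⟨P.jacobi, P.leibniz, P.form_closed⟩
end

section
/- Let (E, ⋆, ρ, (·,·)₋, D) be a pre-symplectic algebroid datum over a commutative ℝ-algebra R, and let F ⊆ E be an R-submodule which is isotropic ((f₁,f₂)₋ = 0 for all f₁,f₂ ∈ F) and closed under ⋆ (f₁⋆f₂ ∈ F for all f₁,f₂ ∈ F). Then (F, ⋆|_F, ρ|_F) is a left-symmetric algebroid datum: for all f₁,f₂,f₃ ∈ F and r ∈ R one has f₁⋆(f₂⋆f₃) − (f₁⋆f₂)⋆f₃ = f₂⋆(f₁⋆f₃) − (f₂⋆f₁)⋆f₃, f₁ ⋆ (r·f₂) = r·(f₁⋆f₂) + ρ(f₁)(r)·f₂,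 and (r·f₁) ⋆ f₂ = r·(f₁⋆f₂). -/
namespace PreSympAlgebroid

variable {R E : Type*} [CommRing R] [Algebra ℝ R]
  [AddCommGroup E] [Module R E] [Module ℝ E] [IsScalarTower ℝ R E]
  (P : PreSympAlgebroid R E)

theorem ext_form {x y : E} (h : ∀ e, P.form x e = P.form y e) : x = y :=
  sub_eq_zero.mp <| P.form_nondeg _ fun e => by simp [h e]

theorem form_star (a b c : E) :
    P.form (P.star a b) c = P.rho a (P.form b c)
      + algebraMap ℝ R 2⁻¹ * P.rho c (P.form a b)
      - P.form b (P.star a c - P.star c a) := by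
  have h := P.axiom_ii a b c
  rw [map_sub, LinearMap.sub_apply, LinearMap.map_smul_of_tower, LinearMap.smul_apply,
    P.form_D, Algebra.smul_def] at h
  linear_combination -h

theorem form_star_add_form_star_swap (a b c : E) :
    P.form (P.star a b) c + P.form (P.star c b) a
      = algebraMap ℝ R 2⁻¹ * (P.rho c (P.form b a) + P.rho a (P.form b c)) := by
  have h₁ := P.form_star b a c
  have h₂ := P.form_star b c a
  rw [map_sub, P.form_skew a (P.star b c), P.form_skew a (P.star c b)] at h₁
  rw [map_sub, P.form_skew c (P.star b a), P.form_skew c (P.star a b),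
    P.form_skew c a, map_neg] at h₂
  linear_combination h₁ + h₂

theorem star_smul_right (a b : E) (r : R) :
    P.star a (r • b) = r • P.star a b + P.rho a r • b
      + (algebraMap ℝ R 2⁻¹ * P.form a b) • P.D r := by
  refine P.ext_form fun e => ?_
  simp only [P.form_star, map_add, map_smul, LinearMap.add_apply, LinearMap.smul_apply,
    smul_eq_mul, Derivation.leibniz, P.form_D]
  ring

theorem star_smul_left (a b : E) (r : R) :
    P.star (r • a) b = r • P.star a b
      + (algebraMap ℝ R 2⁻¹ * P.form b a) • P.D r := by
  refine P.ext_form fun e => ?_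
  have h₁ := P.form_star_add_form_star_swap (r • a) b e
  have h₂ := P.form_star_add_form_star_swap a b e
  simp only [map_smul, Derivation.smul_apply, smul_eq_mul, Derivation.leibniz] at h₁
  simp only [map_add, map_smul, LinearMap.add_apply, LinearMap.smul_apply,
    smul_eq_mul, P.form_D]
  linear_combination h₁ - r * h₂

end PreSympAlgebroid

/-- Let F ⊆ E be an R-submodule of a pre-symplectic algebroid datum
which is isotropic and closed under ⋆. Then (F, ⋆|_F, ρ|_F) is a left-symmetric
algebroid datum: the associator of ⋆ is symmetric on F, and the two anchor/
linearity conditions hold on F. -/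
theorem dirac_structure_left_symmetric_algebroid
    (R E : Type*) [CommRing R] [Algebra ℝ R]
    [AddCommGroup E] [Module R E] [Module ℝ E] [IsScalarTower ℝ R E]
    (P : PreSympAlgebroid R E) (F : Submodule R E)
    (hiso : ∀ f₁ ∈ F, ∀ f₂ ∈ F, P.form f₁ f₂ = 0)
    (hclosed : ∀ f₁ ∈ F, ∀ f₂ ∈ F, P.star f₁ f₂ ∈ F) :
    (∀ f₁ ∈ F, ∀ f₂ ∈ F, ∀ f₃ ∈ F,
      P.star f₁ (P.star f₂ f₃) - P.star (P.star f₁ f₂) f₃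
        = P.star f₂ (P.star f₁ f₃) - P.star (P.star f₂ f₁) f₃) ∧
    (∀ f₁ ∈ F, ∀ f₂ ∈ F, ∀ r : R,
      P.star f₁ (r • f₂) = r • P.star f₁ f₂ + P.rho f₁ r • f₂) ∧
    (∀ f₁ ∈ F, ∀ f₂ ∈ F, ∀ r : R,
      P.star (r • f₁) f₂ = r • P.star f₁ f₂) := by
  refine ⟨fun a ha b hb c hc => ?_, fun a ha b hb r => ?_, fun a ha b hb r => ?_⟩
  · have h := P.axiom_i a b c
    rw [hiso _ (hclosed a ha b hb) c hc, hiso a ha _ (hclosed b hb c hc),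
      hiso _ (hclosed b hb a ha) c hc, hiso b hb _ (hclosed a ha c hc)] at h
    simp only [add_zero, sub_zero, map_zero, smul_zero] at h
    rw [← sub_eq_zero, ← h]
    abel
  · rw [P.star_smul_right, hiso a ha b hb, mul_zero, zero_smul, add_zero]
  · rw [P.star_smul_left, hiso b hb a ha, mul_zero, zero_smul, add_zero]
end
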